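/- Let M = (M^m)_{m≥0} be a mould with M^0 = 0 and M^1 = 0 which is alternal and such that swap(M) + C is alternil for some constant mould C = (C_m). Then the identity ũ(M)^4(x_1,x_3,x_2,x_4) + ũ(M)^4(x_1,x_3,x_4,x_2) + ũ(M)^4(x_2,x_3,x_4,x_1) + coll^4_{3,4}(ũ(M))(x_1,x_3,x_2,x_4) + coll^4_{1,2}(ũ(M))(x_1,x_2,x_3,x_4) = −3·C_3 holds in ℚ(x_1,x_2,x_3,x_4). -/

import Mathlib

open MvPolynomial
open scoped TensorProduct

open MvPolynomial

/-- A mould: a family `M = (M^m)_{m ≥ 0}` with `M^m ∈ ℚ[x_1,…,x_m]`. -/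
abbrev Mould : Type := (m : ℕ) → MvPolynomial (Fin m) ℚ

/-- Evaluation of the depth-`m` component of a mould at a vector `v`. -/
noncomputable def mEval {K : Type} [CommRing K] (f : ℚ →+* K) (M : Mould) {m : ℕ}
    (v : Fin m → K) : K :=
  MvPolynomial.eval₂ f v (M m)

/-- The rational function field `ℚ(x_1,…,x_n)`. -/
abbrev FF (n : ℕ) : Type := FractionRing (MvPolynomial (Fin n) ℚ)

/-- The variable `x_i` as an element of `ℚ(x_1,…,x_n)`. -/
noncomputable def xv {n : ℕ} (i : Fin n) : FF n :=
  algebraMap (MvPolynomial (Fin n) ℚ) (FF n) (X i)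

/-- Ecalle's senary relation at depth `r = s+1`, as an identity in `ℚ(y_1,…,y_r)`:
`M^r(y_1,…,y_r) + (M^{r-1}(y_1,…,y_{r-2},y_{r-1}+y_r) - M^{r-1}(y_1,…,y_{r-1}))/y_r
 = M^r(-y_1-⋯-y_r, y_1,…,y_{r-1})
   + (M^{r-1}(-y_2-⋯-y_r, y_2,…,y_{r-1}) - M^{r-1}(y_1,…,y_{r-1}))/(y_1+⋯+y_r)`. -/
noncomputable def SenaryAt (M : Mould) (s : ℕ) : Prop :=
  mEval (Rat.castHom (FF (s+1))) M (fun i : Fin (s+1) => xv i)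
    + (mEval (Rat.castHom (FF (s+1))) M (fun i : Fin s =>
          if i.val = s - 1 then xv (⟨s-1, by omega⟩ : Fin (s+1)) + xv (Fin.last s)
          else xv i.castSucc)
       - mEval (Rat.castHom (FF (s+1))) M (fun i : Fin s => xv i.castSucc)) / xv (Fin.last s)
  = mEval (Rat.castHom (FF (s+1))) M (fun i : Fin (s+1) =>
        if i.val = 0 then -(∑ j : Fin (s+1), xv j)
        else xv (⟨i.val - 1, by have := i.isLt; omega⟩ : Fin (s+1)))
    + (mEval (Rat.castHom (FF (s+1))) M (fun i : Fin s =>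
          if i.val = 0 then -(∑ j : Fin s, xv j.succ) else xv i.castSucc)
       - mEval (Rat.castHom (FF (s+1))) M (fun i : Fin s => xv i.castSucc))
      / (∑ j : Fin (s+1), xv j)
/-- Evaluation of `ũ(M)^{m+1}` (where `ũ = t̃ ∘ swap`):
`ũ(M)^{m+1}(v_1,…,v_{m+1}) = M^m(v_{m+1}-v_1, v_m-v_{m+1}, v_{m-1}-v_m, …, v_2-v_3)`. -/
noncomputable def uEval {K : Type} [CommRing K] (f : ℚ →+* K) (M : Mould) {m : ℕ}
    (v : Fin (m+1) → K) : K :=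
  mEval f M (fun j : Fin m =>
    if h : j.val = 0 then v (Fin.last m) - v 0
    else v ⟨m - j.val, by omega⟩ - v ⟨m - j.val + 1, by have := j.isLt; omega⟩)

/-- `coll^{t+2}_{i,i+1}` (with `1`-indexed `i = k+1`) applied to `N = ũ(M)`,
evaluated at `v = (x_1,…,x_{t+2})`:
`(N^{t+1}(x_1,…,x_i,x_{i+2},…) - N^{t+1}(x_1,…,x_{i-1},x_{i+1},x_{i+2},…))/(x_i - x_{i+1})`. -/
noncomputable def collUEval {K : Type} [Field K] (f : ℚ →+* K) (M : Mould) {t : ℕ}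
    (k : Fin (t+1)) (v : Fin (t+2) → K) : K :=
  (uEval f M (fun j : Fin (t+1) => v (Fin.succAbove k.succ j))
    - uEval f M (fun j : Fin (t+1) => v (Fin.succAbove k.castSucc j)))
    / (v k.castSucc - v k.succ)
/-- The swap of a mould: `swap(M)^m(v_1,…,v_m) = M^m(v_m, v_{m-1}-v_m, …, v_1-v_2)`. -/
noncomputable def swapM (M : Mould) : Mould := fun m =>
  MvPolynomial.eval₂ MvPolynomial.C
    (fun i : Fin m =>
      (MvPolynomial.X ⟨m - 1 - i.val, by have := i.isLt; omega⟩ : MvPolynomial (Fin m) ℚ)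
        - (if h : i.val = 0 then 0
           else MvPolynomial.X ⟨m - i.val, by have := i.isLt; omega⟩))
    (M m)

open scoped Classical in
/-- Alternality of a mould: `M^0 = 0` and for all `p, q ≥ 1` the sum of
`M^{p+q}(x_{σ(1)},…,x_{σ(p+q)})` over the `(p,q)`-shuffle permutations vanishes. -/
noncomputable def IsAlternal (M : Mould) : Prop :=
  M 0 = 0 ∧ ∀ p q : ℕ, 1 ≤ p → 1 ≤ q →
    ∑ σ : Equiv.Perm (Fin (p+q)),
      (if ((∀ i j : Fin (p+q), i < j → j.val < p → σ.symm i < σ.symm j) ∧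
           (∀ i j : Fin (p+q), i < j → p ≤ i.val → σ.symm i < σ.symm j))
       then MvPolynomial.eval₂ MvPolynomial.C
              (fun i => (X (σ i) : MvPolynomial (Fin (p+q)) ℚ)) (M (p+q))
       else 0) = 0

/-- The field `ℚ(y_1, y_2, …)` (the variable `X i` stands for `y_{i+1}`). -/
abbrev Kinf : Type := FractionRing (MvPolynomial ℕ ℚ)

noncomputable def yvar (i : ℕ) : Kinf := algebraMap (MvPolynomial ℕ ℚ) Kinf (X i)

/-- A letter: a `ℤ`-linear combination of the letters `x_1, x_2, …`
(the generator `i` stands for `x_{i+1}`). -/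
abbrev Letter : Type := ℕ →₀ ℤ

/-- The value of a letter under `x_i ↦ y_i`. -/
noncomputable def letterVal (l : Letter) : Kinf := l.sum fun i n => (n : Kinf) * yvar i

/-- `f(u) = 1/(n_1 y_{i_1} + ⋯ + n_k y_{i_k})` for `u = n_1 x_{i_1} + ⋯ + n_k x_{i_k} ≠ 0`,
and `f(0) = 0`. -/
noncomputable def collide (l : Letter) : Kinf := (letterVal l)⁻¹

/-- The `ш*` product of two words, as a formal `ℚ(y_1,y_2,…)`-linear combination of words:
`uω ш* vη = u(ω ш* vη) + v(uω ш* η) + f(u-v)·(u(ω ш* η) - v(ω ш* η))`. -/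
noncomputable def shMul : List Letter → List Letter → (List Letter →₀ Kinf)
  | [], η => Finsupp.single η 1
  | ω, [] => Finsupp.single ω 1
  | u :: ω, v :: η =>
      Finsupp.mapDomain (List.cons u) (shMul ω (v :: η))
        + Finsupp.mapDomain (List.cons v) (shMul (u :: ω) η)
        + collide (u - v) • (Finsupp.mapDomain (List.cons u) (shMul ω η)
            - Finsupp.mapDomain (List.cons v) (shMul ω η))
  termination_by ω η => ω.length + η.length

/-- `N^{l(α)}(α)`, evaluated with `y_i := x_i`. -/
noncomputable def wordEval (N : Mould) (α : List Letter) : Kinf :=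
  MvPolynomial.eval₂ (Rat.castHom Kinf) (fun j : Fin α.length => letterVal (α.get j))
    (N α.length)

/-- Alternility of a mould: `N^0 = 0` and for all `p, q ≥ 1`,
`Σ_α ⟨(x_1,…,x_p) ш* (x_{p+1},…,x_{p+q}) | α⟩|_{y_i := x_i} · N^{l(α)}(α) = 0`. -/
noncomputable def IsAlternil (N : Mould) : Prop :=
  N 0 = 0 ∧ ∀ p q : ℕ, 1 ≤ p → 1 ≤ q →
    (shMul ((List.range p).map fun j => Finsupp.single j 1)
           ((List.range q).map fun j => Finsupp.single (p + j) 1)).sum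
      (fun α c => c * wordEval N α) = 0

theorem mEval_congr {K : Type} [CommRing K] (f : ℚ →+* K) (M : Mould) {m : ℕ}
    {v w : Fin m → K} (h : ∀ i, v i = w i) : mEval f M v = mEval f M w := by
  rw [funext h]

theorem map_mEval {K L : Type} [CommRing K] [CommRing L] (f : ℚ →+* K) (φ : K →+* L) (M : Mould)
    {m : ℕ} (v : Fin m → K) : φ (mEval f M v) = mEval (φ.comp f) M (fun i => φ (v i)) := by
  simp only [mEval]
  rw [MvPolynomial.hom_eval₂]

theorem eval₂Hom_mEval {σ K : Type} [CommRing K] (f : ℚ →+* K) (w : σ → K) (M : Mould) {m : ℕ}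
    (g : Fin m → MvPolynomial σ ℚ) :
    MvPolynomial.eval₂Hom f w (mEval MvPolynomial.C M g)
      = mEval f M (fun i => MvPolynomial.eval₂Hom f w (g i)) := by
  rw [map_mEval, MvPolynomial.eval₂Hom_comp_C]

theorem mEval_add_const {K : Type} [CommRing K] (f : ℚ →+* K) (M : Mould) (c : ℕ → ℚ) {m : ℕ}
    (v : Fin m → K) :
    mEval f (fun m => M m + MvPolynomial.C (c m)) v = mEval f M v + f (c m) := by
  simp [mEval]

theorem mEval_swapM {K : Type} [CommRing K] (f : ℚ →+* K) (M : Mould) {m : ℕ} (v : Fin m → K) :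
    mEval f (swapM M) v = mEval f M (fun i : Fin m =>
      v ⟨m - 1 - i.val, by have := i.isLt; omega⟩
        - (if h : i.val = 0 then 0 else v ⟨m - i.val, by have := i.isLt; omega⟩)) := by
  have h := eval₂Hom_mEval f v M (fun i : Fin m =>
      (MvPolynomial.X ⟨m - 1 - i.val, by have := i.isLt; omega⟩ : MvPolynomial (Fin m) ℚ)
        - (if h : i.val = 0 then 0
           else MvPolynomial.X ⟨m - i.val, by have := i.isLt; omega⟩))
  refine h.trans (mEval_congr f M fun i => ?_)
  split_ifs <;> simp

theorem mEval_swapM_two {K : Type} [CommRing K] (f : ℚ →+* K) (M : Mould) (a b : K) :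
    mEval f (swapM M) ![a, b] = mEval f M ![b, a - b] := by
  rw [mEval_swapM]
  refine mEval_congr f M fun i => ?_
  fin_cases i <;> simp

theorem mEval_swapM_three {K : Type} [CommRing K] (f : ℚ →+* K) (M : Mould) (a b c : K) :
    mEval f (swapM M) ![a, b, c] = mEval f M ![c, b - c, a - b] := by
  rw [mEval_swapM]
  refine mEval_congr f M fun i => ?_
  fin_cases i <;> simp

theorem univ_perm_fin_two : (Finset.univ : Finset (Equiv.Perm (Fin 2))) = {1, Equiv.swap 0 1} := by
  decide

theorem univ_perm_fin_three : (Finset.univ : Finset (Equiv.Perm (Fin 3))) =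
    {1, Equiv.swap 0 1, Equiv.swap 1 2, Equiv.swap 0 2, finRotate 3, (finRotate 3).symm} := by
  decide

theorem IsAlternal.antisymm {M : Mould} (h : IsAlternal M) {K : Type} [CommRing K] (f : ℚ →+* K)
    (a b : K) : mEval f M ![a, b] = -mEval f M ![b, a] := by
  have h := h.2 1 1 le_rfl le_rfl
  change ∑ σ : Equiv.Perm (Fin 2), _ = _ at h
  rw [univ_perm_fin_two, Finset.sum_insert (by decide), Finset.sum_singleton,
    if_pos (by decide), if_pos (by decide)] at h
  change mEval MvPolynomial.C M (m := 2) (fun i => X ((1 : Equiv.Perm (Fin 2)) i))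
    + mEval MvPolynomial.C M (m := 2) (fun i => X (Equiv.swap (0 : Fin 2) 1 i)) = 0 at h
  have h := congrArg (MvPolynomial.eval₂Hom f ![a, b]) h
  simp only [map_add, map_zero, eval₂Hom_mEval, MvPolynomial.eval₂Hom_X'] at h
  rw [← add_eq_zero_iff_eq_neg, ← h]
  congr 1
  all_goals
    refine mEval_congr f M fun i => ?_
    fin_cases i <;> rfl

theorem IsAlternal.shuffle_three {M : Mould} (h : IsAlternal M) {K : Type} [CommRing K]
    (f : ℚ →+* K) (a b c : K) :
    mEval f M ![a, b, c] + mEval f M ![b, a, c] + mEval f M ![b, c, a] = 0 := by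
  have h := h.2 1 2 le_rfl one_le_two
  change ∑ σ : Equiv.Perm (Fin 3), _ = _ at h
  rw [univ_perm_fin_three, Finset.sum_insert (by decide), Finset.sum_insert (by decide),
    Finset.sum_insert (by decide), Finset.sum_insert (by decide), Finset.sum_insert (by decide),
    Finset.sum_singleton,
    if_pos (by decide), if_pos (by decide), if_neg (by decide), if_neg (by decide),
    if_pos (by decide), if_neg (by decide)] at h
  simp only [zero_add, add_zero] at h
  change mEval MvPolynomial.C M (m := 3) (fun i => X ((1 : Equiv.Perm (Fin 3)) i))
    + (mEval MvPolynomial.C M (m := 3) (fun i => X (Equiv.swap (0 : Fin 3) 1 i))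
      + mEval MvPolynomial.C M (m := 3) (fun i => X (finRotate 3 i))) = 0 at h
  have h := congrArg (MvPolynomial.eval₂Hom f ![a, b, c]) h
  simp only [map_add, map_zero, eval₂Hom_mEval, MvPolynomial.eval₂Hom_X', ← add_assoc] at h
  rw [← h]
  congr 1
  congr 1
  all_goals
    refine mEval_congr f M fun i => ?_
    fin_cases i <;> rfl

theorem wordEval_eq_mEval (N : Mould) {n : ℕ} (g : Fin n → MvPolynomial ℕ ℚ) (α : List Letter)
    (hl : α.length = n)
    (hg : ∀ i : Fin α.length, letterVal (α.get i)
      = algebraMap (MvPolynomial ℕ ℚ) Kinf (g (Fin.cast hl i))) :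
    wordEval N α = algebraMap (MvPolynomial ℕ ℚ) Kinf (mEval MvPolynomial.C N g) := by
  subst hl
  rw [map_mEval]
  simp only [wordEval, mEval]
  congr 1
  · exact Subsingleton.elim _ _
  · exact funext hg

theorem letterVal_single (i : ℕ) :
    letterVal (Finsupp.single i 1) = algebraMap (MvPolynomial ℕ ℚ) Kinf (X i) := by
  simp [letterVal, yvar]

theorem wordEval_two (N : Mould) (i j : ℕ) :
    wordEval N [Finsupp.single i 1, Finsupp.single j 1]
      = algebraMap (MvPolynomial ℕ ℚ) Kinf (mEval MvPolynomial.C N ![X i, X j]) := by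
  refine wordEval_eq_mEval N _ _ rfl fun k => ?_
  fin_cases k <;> exact letterVal_single _

theorem wordEval_three (N : Mould) (i j k : ℕ) :
    wordEval N [Finsupp.single i 1, Finsupp.single j 1, Finsupp.single k 1]
      = algebraMap (MvPolynomial ℕ ℚ) Kinf (mEval MvPolynomial.C N ![X i, X j, X k]) := by
  refine wordEval_eq_mEval N _ _ rfl fun k => ?_
  fin_cases k <;> exact letterVal_single _

theorem collide_single_sub_single (i j : ℕ) :
    collide (Finsupp.single i 1 - Finsupp.single j 1)
      = (algebraMap (MvPolynomial ℕ ℚ) Kinf (X i - X j))⁻¹ := by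
  have h : letterVal (Finsupp.single i 1 - Finsupp.single j 1)
      = letterVal (Finsupp.single i 1) - letterVal (Finsupp.single j 1) := by
    refine Finsupp.sum_sub_index fun a b c => ?_
    push_cast
    ring
  rw [collide, h, letterVal_single, letterVal_single, map_sub]

/-- The linear extension of a function on words to formal combinations of words. -/
noncomputable def wordSum (w : List Letter → Kinf) : (List Letter →₀ Kinf) →ₗ[Kinf] Kinf :=
  Finsupp.linearCombination Kinf w

theorem wordSum_single (w : List Letter → Kinf) (α : List Letter) :
    wordSum w (Finsupp.single α 1) = w α := by
  simp [wordSum]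

theorem wordSum_mapDomain (w : List Letter → Kinf) (u : Letter) (F : List Letter →₀ Kinf) :
    wordSum w (Finsupp.mapDomain (List.cons u) F) = wordSum (fun α => w (u :: α)) F := by
  rw [wordSum, wordSum, Finsupp.linearCombination_mapDomain]
  rfl

theorem wordSum_shMul_cons_cons (w : List Letter → Kinf) (u v : Letter) (ω η : List Letter) :
    wordSum w (shMul (u :: ω) (v :: η))
      = wordSum (fun α => w (u :: α)) (shMul ω (v :: η))
        + wordSum (fun α => w (v :: α)) (shMul (u :: ω) η)
        + collide (u - v) * (wordSum (fun α => w (u :: α)) (shMul ω η)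
            - wordSum (fun α => w (v :: α)) (shMul ω η)) := by
  rw [shMul]
  simp only [map_add, map_smul, map_sub, wordSum_mapDomain, smul_eq_mul]

theorem wordSum_shMul_nil_left (w : List Letter → Kinf) (η : List Letter) :
    wordSum w (shMul [] η) = w η := by
  rw [shMul, wordSum_single]

theorem wordSum_shMul_nil_right (w : List Letter → Kinf) (ω : List Letter) :
    wordSum w (shMul ω []) = w ω := by
  cases ω <;> rw [shMul, wordSum_single]
  simp

theorem IsAlternil.wordSum_eq_zero {N : Mould} (h : IsAlternil N) (p q : ℕ) (hp : 1 ≤ p)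
    (hq : 1 ≤ q) :
    wordSum (wordEval N) (shMul ((List.range p).map fun j => Finsupp.single j 1)
      ((List.range q).map fun j => Finsupp.single (p + j) 1)) = 0 := by
  rw [← h.2 p q hp hq, wordSum, Finsupp.linearCombination_apply]
  simp only [smul_eq_mul]

theorem X_sub_X_ne_zero {i j : ℕ} (h : i ≠ j) :
    algebraMap (MvPolynomial ℕ ℚ) Kinf (X i - X j) ≠ 0 := by
  rw [Ne, FaithfulSMul.algebraMap_eq_zero_iff, sub_eq_zero]
  exact fun e => h (MvPolynomial.X_injective e)

theorem IsAlternil.depth_two {N : Mould} (h : IsAlternil N) {κ : ℚ} (h1 : N 1 = MvPolynomial.C κ)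
    {K : Type} [CommRing K] (f : ℚ →+* K) (a b : K) :
    mEval f N ![a, b] + mEval f N ![b, a] = 0 := by
  have e := h.wordSum_eq_zero 1 1 le_rfl le_rfl
  have hone : ∀ u : Letter, wordEval N [u] = Rat.castHom Kinf κ := fun u => by
    change MvPolynomial.eval₂ _ _ (N 1) = _
    rw [h1, MvPolynomial.eval₂_C]
  simp only [List.range_succ, List.range_zero, List.nil_append, List.map_cons, List.map_nil,
    wordSum_shMul_cons_cons, wordSum_shMul_nil_left, wordSum_shMul_nil_right, hone, sub_self,
    mul_zero, add_zero, wordEval_two] at e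
  rw [← map_add, FaithfulSMul.algebraMap_eq_zero_iff] at e
  have e := congrArg (MvPolynomial.eval₂Hom f fun i => if i = 0 then a else b) e
  rw [map_add, map_zero, eval₂Hom_mEval, eval₂Hom_mEval] at e
  rw [← e]
  congr 1
  all_goals
    refine mEval_congr f N fun i => ?_
    fin_cases i <;> simp

theorem IsAlternil.depth_three {N : Mould} (h : IsAlternil N) {K : Type} [Field K] (f : ℚ →+* K)
    {a b c : K} (hab : a - b ≠ 0) (hac : a - c ≠ 0) :
    mEval f N ![a, b, c] + mEval f N ![b, a, c] + mEval f N ![b, c, a]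
      + (mEval f N ![a, c] - mEval f N ![b, c]) / (a - b)
      + (mEval f N ![b, a] - mEval f N ![b, c]) / (a - c) = 0 := by
  have e := h.wordSum_eq_zero 1 2 le_rfl one_le_two
  simp only [List.range_succ, List.range_zero, List.nil_append, List.map_cons, List.map_nil,
    List.cons_append, wordSum_shMul_cons_cons, wordSum_shMul_nil_left, wordSum_shMul_nil_right,
    wordEval_two, wordEval_three, collide_single_sub_single] at e
  norm_num only [zero_add, add_zero] at e
  have n₁ := X_sub_X_ne_zero (i := 0) (j := 1) (by decide)
  have n₂ := X_sub_X_ne_zero (i := 0) (j := 2) (by decide)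
  have e' : (mEval MvPolynomial.C N ![X 0, X 1, X 2] + mEval MvPolynomial.C N ![X 1, X 0, X 2]
        + mEval MvPolynomial.C N ![X 1, X 2, X 0]) * ((X 0 - X 1) * (X 0 - X 2))
      + (mEval MvPolynomial.C N ![X 0, X 2] - mEval MvPolynomial.C N ![X 1, X 2]) * (X 0 - X 2)
      + (mEval MvPolynomial.C N ![X 1, X 0] - mEval MvPolynomial.C N ![X 1, X 2]) * (X 0 - X 1)
        = (0 : MvPolynomial ℕ ℚ) := by
    apply FaithfulSMul.algebraMap_injective (MvPolynomial ℕ ℚ) Kinf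
    simp only [map_add, map_mul, map_sub, map_zero] at e n₁ n₂ ⊢
    field_simp at e
    linear_combination e
  have e' := congrArg (MvPolynomial.eval₂Hom f fun i => if i = 0 then a else if i = 1 then b else c)
    e'
  have key₃ : ∀ i j k : ℕ, (fun l => MvPolynomial.eval₂Hom f
      (fun i => if i = 0 then a else if i = 1 then b else c)
      ((![X i, X j, X k] : Fin 3 → MvPolynomial ℕ ℚ) l))
      = ![if i = 0 then a else if i = 1 then b else c, if j = 0 then a else if j = 1 then b else c,
        if k = 0 then a else if k = 1 then b else c] := fun i j k => by
    funext l
    fin_cases l <;> simp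
  have key₂ : ∀ i j : ℕ, (fun l => MvPolynomial.eval₂Hom f
      (fun i => if i = 0 then a else if i = 1 then b else c)
      ((![X i, X j] : Fin 2 → MvPolynomial ℕ ℚ) l))
      = ![if i = 0 then a else if i = 1 then b else c,
        if j = 0 then a else if j = 1 then b else c] := fun i j => by
    funext l
    fin_cases l <;> simp
  simp only [map_add, map_mul, map_sub, map_zero, eval₂Hom_mEval, key₂, key₃,
    MvPolynomial.eval₂Hom_X', if_true, one_ne_zero, OfNat.ofNat_ne_zero, if_false,
    OfNat.ofNat_ne_one] at e'
  field_simp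
  linear_combination e'

section Senary

variable {K : Type} [Field K] {P : K → K → K → K} {Q : K → K → K}

theorem apply_neg_neg_of_antisymm (hQ : ∀ a b, Q a b = -Q b a)
    (hQ' : ∀ a b, Q a b = -Q (a + b) (-b)) (a b : K) : Q (-a) (-b) = Q a b := by
  rw [hQ' a b, hQ (a + b) (-b), hQ' (-b) (a + b), show -b + (a + b) = a by ring,
    hQ a (-(a + b)), hQ' (-(a + b)) a, show -(a + b) + a = -b by ring, hQ (-b) (-a)]
  ring

theorem apply_cycle_of_antisymm (hQ : ∀ a b, Q a b = -Q b a)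
    (hQ' : ∀ a b, Q a b = -Q (a + b) (-b)) (a b : K) : Q (-(a + b)) a = Q a b := by
  rw [hQ' (-(a + b)) a, show -(a + b) + a = -b by ring, hQ (-b) (-a), neg_neg,
    apply_neg_neg_of_antisymm hQ hQ']

/-- The relation between `P(y₁, y₂, y₃)` and `P(-y₂, -y₃, -y₀)` for `y₀ + y₁ + y₂ + y₃ = 0` -/
theorem neg_push_of_alternil
    (hP : ∀ a b c, P a b c + P b a c + P b c a = 0)
    (hQ : ∀ a b, Q a b = -Q b a) (hQ' : ∀ a b, Q a b = -Q (a + b) (-b)) (κ : K)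
    (hil : ∀ a b c, a - b ≠ 0 → a - c ≠ 0 →
      P c (b - c) (a - b) + P c (a - c) (b - a) + P a (c - a) (b - c) + κ
        + (Q c (a - c) - Q c (b - c)) / (a - b) + (Q a (b - a) - Q c (b - c)) / (a - c) = 0)
    {y₀ y₁ y₂ y₃ : K} (h : y₀ + y₁ + y₂ + y₃ = 0) (h₂ : y₂ ≠ 0) (h₃ : y₃ ≠ 0)
    (h₂₃ : y₂ + y₃ ≠ 0) :
    P y₁ y₂ y₃ - P (-y₂) (-y₃) (-y₀)
      = (Q y₀ y₁ + Q y₀ y₃) / y₂ - (Q y₀ y₁ - Q y₁ y₂) / y₃ := by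
  have hneg := apply_neg_neg_of_antisymm hQ hQ'
  have q₁ : Q y₁ (-(y₀ + y₁)) = Q y₀ y₁ := by
    rw [hQ' y₀ y₁, ← hneg (y₀ + y₁) (-y₁), neg_neg, ← hQ]
  have q₂ : Q (-y₀) (y₀ + y₁) = -Q y₀ y₁ := by
    rw [hQ' (-y₀), show -y₀ + (y₀ + y₁) = y₁ by ring, q₁]
  have e₁ := hil (-y₀) (y₁ + y₂) y₁
  have e₂ := hil y₁ (y₁ + y₂) (-y₀)
  rw [show y₁ + y₂ - y₁ = y₂ by ring, show -y₀ - (y₁ + y₂) = y₃ by linear_combination -h,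
    show -y₀ - y₁ = -(y₀ + y₁) by ring, show y₁ + y₂ - -y₀ = -y₃ by linear_combination h,
    show y₁ - -y₀ = y₀ + y₁ by ring, q₁, hneg] at e₁
  rw [show y₁ + y₂ - -y₀ = -y₃ by linear_combination h, show y₁ - (y₁ + y₂) = -y₂ by ring,
    show y₁ - -y₀ = y₀ + y₁ by ring, show y₁ + y₂ - y₁ = y₂ by ring,
    show -y₀ - y₁ = -(y₀ + y₁) by ring, q₂, hneg] at e₂
  have hD : y₀ + y₁ ≠ 0 := fun hD => h₂₃ (by linear_combination h - hD)
  have e₁ := e₁ h₃ (neg_ne_zero.2 hD)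
  have e₂ := e₂ (neg_ne_zero.2 h₂) hD
  simp only [div_neg] at e₁ e₂
  linear_combination e₁ - e₂ - hP (-y₂) (-y₃) (-y₀) + hP (-y₀) (-y₃) (-y₂)

/-- The senary relation in depth three, as a cyclic relation in `y₀ + y₁ + y₂ + y₃ = 0`. -/
theorem push_of_neg_push
    (hP : ∀ a b c, P a b c + P b a c + P b c a = 0) (hQ : ∀ a b, Q a b = -Q b a)
    (hN : ∀ y₀ y₁ y₂ y₃ : K, y₀ + y₁ + y₂ + y₃ = 0 → y₂ ≠ 0 → y₃ ≠ 0 → y₂ + y₃ ≠ 0 →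
      P y₁ y₂ y₃ - P (-y₂) (-y₃) (-y₀)
        = (Q y₀ y₁ + Q y₀ y₃) / y₂ - (Q y₀ y₁ - Q y₁ y₂) / y₃)
    {y₀ y₁ y₂ y₃ : K} (h : y₀ + y₁ + y₂ + y₃ = 0) (h₀ : y₀ ≠ 0) (h₁ : y₁ ≠ 0) (h₂ : y₂ ≠ 0)
    (h₃ : y₃ ≠ 0) (h₀₁ : y₀ + y₁ ≠ 0) (h₀₂ : y₀ + y₂ ≠ 0) (h₀₃ : y₀ + y₃ ≠ 0) :
    P y₀ y₁ y₂ - P y₁ y₂ y₃ = (Q y₀ y₁ - Q y₁ y₂) / y₃ + (Q y₂ y₃ - Q y₁ y₂) / y₀ := by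
  have n₁ := hN y₀ y₂ y₃ y₁ (by linear_combination h) h₃ h₁
    fun e => h₀₂ (by linear_combination h - e)
  have n₂ := hN y₀ y₂ y₁ y₃ (by linear_combination h) h₁ h₃
    fun e => h₀₂ (by linear_combination h - e)
  have n₃ := hN y₁ y₂ y₃ y₀ (by linear_combination h) h₃ h₀
    fun e => h₀₃ (by linear_combination e)
  have n₄ := hN y₁ y₀ y₃ y₂ (by linear_combination h) h₃ h₂
    fun e => h₀₁ (by linear_combination h - e)
  have n₅ := hN y₃ y₀ y₁ y₂ (by linear_combination h) h₁ h₂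
    fun e => h₀₃ (by linear_combination h - e)
  simp only [hQ y₁ y₀, hQ y₃ y₀, hQ y₂ y₁, hQ y₃ y₂] at n₁ n₂ n₃ n₄ n₅
  linear_combination -hP (-y₁) (-y₀) (-y₃) + hP (-y₀) (-y₁) (-y₃) + hP (-y₀) (-y₃) (-y₁)
    - hP y₁ y₂ y₃ - hP y₀ y₂ y₃ - hP (-y₁) (-y₃) (-y₂) + hP y₂ y₀ y₃ + hP (-y₃) (-y₁) (-y₂)
    + n₁ + n₂ + n₃ - n₄ + n₅

end Senary

theorem uEval_three {K : Type} [CommRing K] (f : ℚ →+* K) (M : Mould) (p q r : K) :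
    uEval f M ![p, q, r] = mEval f M ![r - p, q - r] := by
  refine mEval_congr f M fun i => ?_
  fin_cases i <;> rfl

theorem uEval_four {K : Type} [CommRing K] (f : ℚ →+* K) (M : Mould) (p q r s : K) :
    uEval f M ![p, q, r, s] = mEval f M ![s - p, r - s, q - r] := by
  refine mEval_congr f M fun i => ?_
  fin_cases i <;> rfl

theorem collUEval_two {K : Type} [Field K] (f : ℚ →+* K) (M : Mould) (p q r s : K) :
    collUEval f M 2 ![p, q, r, s]
      = (mEval f M ![r - p, q - r] - mEval f M ![s - p, q - s]) / (r - s) := by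
  rw [← uEval_three, ← uEval_three]
  simp only [collUEval]
  congr 3
  all_goals
    funext i
    fin_cases i <;> rfl

theorem collUEval_zero {K : Type} [Field K] (f : ℚ →+* K) (M : Mould) (p q r s : K) :
    collUEval f M 0 ![p, q, r, s]
      = (mEval f M ![s - p, r - s] - mEval f M ![s - q, r - s]) / (p - q) := by
  rw [← uEval_three, ← uEval_three]
  simp only [collUEval]
  congr 3
  all_goals
    funext i
    fin_cases i <;> rfl

/-- A nonzero value at some rational point shows that a linear form is nonzero in `ℚ(x₁,…,xₙ)`. -/
theorem algebraMap_ne_zero_of_eval {n : ℕ} (v : Fin n → ℚ) (p : MvPolynomial (Fin n) ℚ)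
    (h : MvPolynomial.eval v p ≠ 0) : algebraMap (MvPolynomial (Fin n) ℚ) (FF n) p ≠ 0 := by
  rw [Ne, FaithfulSMul.algebraMap_eq_zero_iff]
  rintro rfl
  exact h (map_zero _)

theorem xv_linear_ne_zero (n₀ n₁ n₂ n₃ : ℚ) (h : 1 * n₀ + 10 * n₁ + 100 * n₂ + 1000 * n₃ ≠ 0) :
    Rat.castHom (FF 4) n₀ * xv 0 + Rat.castHom (FF 4) n₁ * xv 1 + Rat.castHom (FF 4) n₂ * xv 2
      + Rat.castHom (FF 4) n₃ * xv 3 ≠ 0 := by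
  have e := algebraMap_ne_zero_of_eval ![1, 10, 100, 1000]
    (MvPolynomial.C n₀ * X 0 + MvPolynomial.C n₁ * X 1 + MvPolynomial.C n₂ * X 2
      + MvPolynomial.C n₃ * X 3) (by
        simp only [map_add, map_mul, MvPolynomial.eval_C, MvPolynomial.eval_X]
        exact fun e => h (by simpa [mul_comm] using e))
  have hC : ∀ q : ℚ, algebraMap (MvPolynomial (Fin 4) ℚ) (FF 4) (MvPolynomial.C q)
      = Rat.castHom (FF 4) q := fun q =>
    RingHom.congr_fun (Subsingleton.elim
      ((algebraMap (MvPolynomial (Fin 4) ℚ) (FF 4)).comp MvPolynomial.C) (Rat.castHom (FF 4))) q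
  simp only [map_add, map_mul, hC] at e
  exact e

/-- The five-term identity at a point of an arbitrary field where the denominators do not vanish. -/
theorem five_terms_sum_at (M : Mould) (h1 : M 1 = 0) (hal : IsAlternal M) (c : ℕ → ℚ)
    (hil : IsAlternil (fun m => swapM M m + MvPolynomial.C (c m)))
    {K : Type} [Field K] [CharZero K] (f : ℚ →+* K) {x₀ x₁ x₂ x₃ : K}
    (h₀₁ : x₀ - x₁ ≠ 0) (h₃₀ : x₃ - x₀ ≠ 0) (h₂₃ : x₂ - x₃ ≠ 0) (h₁₂ : x₁ - x₂ ≠ 0)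
    (h₁₃ : x₁ - x₃ ≠ 0) (h₀₂ : x₀ - x₂ ≠ 0) (h₀₁₂₃ : x₀ - x₁ + x₂ - x₃ ≠ 0) :
    uEval f M ![x₀, x₂, x₁, x₃] + uEval f M ![x₀, x₂, x₃, x₁] + uEval f M ![x₁, x₂, x₃, x₀]
      + collUEval f M 2 ![x₀, x₂, x₁, x₃] + collUEval f M 0 ![x₀, x₁, x₂, x₃]
      = f (-3 * c 3) := by
  have hQ : ∀ a b : K, mEval f M ![a, b] = -mEval f M ![b, a] := hal.antisymm f
  have hS : ∀ a b : K, mEval f M ![a, b] + mEval f M ![a + b, -b] + 2 * f (c 2) = 0 := fun a b => by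
    have e := hil.depth_two (κ := c 1) (by simp [swapM, h1]) f (a + b) a
    simp only [mEval_add_const, mEval_swapM_two] at e
    rw [show a + b - a = b by ring, show a - (a + b) = -b by ring] at e
    linear_combination e
  have hc : f (c 2) = 0 := by
    have e₁ := hS 0 0
    have e₂ := hQ 0 0
    rw [add_zero, neg_zero] at e₁
    have e₃ : 2 * f (c 2) = 0 := by linear_combination e₁ - e₂
    simpa using e₃
  have hil₃ : ∀ a b d : K, a - b ≠ 0 → a - d ≠ 0 →
      mEval f M ![d, b - d, a - b] + mEval f M ![d, a - d, b - a] + mEval f M ![a, d - a, b - d]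
        + 3 * f (c 3)
        + (mEval f M ![d, a - d] - mEval f M ![d, b - d]) / (a - b)
        + (mEval f M ![a, b - a] - mEval f M ![d, b - d]) / (a - d) = 0 := fun a b d hab had => by
    have e := hil.depth_three f hab had
    simp only [mEval_add_const, mEval_swapM_two, mEval_swapM_three, add_sub_add_right_eq_sub] at e
    linear_combination e
  have hQ' : ∀ a b : K, mEval f M ![a, b] = -mEval f M ![a + b, -b] := fun a b => by
    linear_combination hS a b - 2 * hc
  have hpush := push_of_neg_push (P := fun a b d => mEval f M ![a, b, d])
    (Q := fun a b => mEval f M ![a, b]) (hal.shuffle_three f) hQ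
    (fun y₀ y₁ y₂ y₃ h h₂ h₃ h₂₃ => neg_push_of_alternil (hal.shuffle_three f) hQ hQ' (3 * f (c 3))
      hil₃ h h₂ h₃ h₂₃)
    (y₀ := x₀ - x₁) (y₁ := x₃ - x₀) (y₂ := x₂ - x₃) (y₃ := x₁ - x₂) (by ring) h₀₁ h₃₀ h₂₃ h₁₂
    (fun e => h₁₃ (by linear_combination -e)) (fun e => h₀₁₂₃ (by linear_combination e))
    (fun e => h₀₂ (by linear_combination e))
  have e := hil₃ (x₁ - x₀) (x₂ - x₀) (x₃ - x₀) (fun e => h₁₂ (by linear_combination e))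
    (fun e => h₁₃ (by linear_combination e))
  simp only [sub_sub_sub_cancel_right] at e
  simp only [uEval_four, collUEval_two, collUEval_zero, map_mul, map_neg, map_ofNat]
  have q₁ := apply_cycle_of_antisymm (Q := fun a b => mEval f M ![a, b]) hQ hQ'
    (x₃ - x₀) (x₁ - x₃)
  have q₂ := apply_cycle_of_antisymm (Q := fun a b => mEval f M ![a, b]) hQ hQ'
    (x₂ - x₃) (x₁ - x₂)
  simp only [show -(x₃ - x₀ + (x₁ - x₃)) = x₀ - x₁ by ring,
    show -(x₂ - x₃ + (x₁ - x₂)) = x₃ - x₁ by ring] at q₁ q₂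
  simp only [q₁, ← q₂] at hpush
  linear_combination e + hpush

set_option maxHeartbeats 1000000 in
/-- Let `M` be an alternal mould with `M^0 = 0`, `M^1 = 0` such that
`swap(M) + C` is alternil for a constant mould `C = (C_m)`.  Then
`ũ(M)^4(x_1,x_3,x_2,x_4) + ũ(M)^4(x_1,x_3,x_4,x_2) + ũ(M)^4(x_2,x_3,x_4,x_1)
 + coll^4_{3,4}(ũ(M))(x_1,x_3,x_2,x_4) + coll^4_{1,2}(ũ(M))(x_1,x_2,x_3,x_4) = -3·C_3`
in `ℚ(x_1,x_2,x_3,x_4)`. -/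
theorem five_terms_sum (M : Mould) (h0 : M 0 = 0) (h1 : M 1 = 0)
    (hal : IsAlternal M) (c : ℕ → ℚ)
    (hil : IsAlternil (fun m => swapM M m + MvPolynomial.C (c m))) :
    uEval (Rat.castHom (FF 4)) M ![xv 0, xv 2, xv 1, xv 3]
        + uEval (Rat.castHom (FF 4)) M ![xv 0, xv 2, xv 3, xv 1]
        + uEval (Rat.castHom (FF 4)) M ![xv 1, xv 2, xv 3, xv 0]
        + collUEval (Rat.castHom (FF 4)) M 2 ![xv 0, xv 2, xv 1, xv 3]
        + collUEval (Rat.castHom (FF 4)) M 0 ![xv 0, xv 1, xv 2, xv 3]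
      = Rat.castHom (FF 4) (-3 * c 3) := by
  have key := xv_linear_ne_zero
  refine five_terms_sum_at M h1 hal c hil (Rat.castHom (FF 4)) ?_ ?_ ?_ ?_ ?_ ?_ ?_
  · exact fun e => key 1 (-1) 0 0 (by norm_num) (by simp; linear_combination e)
  · exact fun e => key (-1) 0 0 1 (by norm_num) (by simp; linear_combination e)
  · exact fun e => key 0 0 1 (-1) (by norm_num) (by simp; linear_combination e)
  · exact fun e => key 0 1 (-1) 0 (by norm_num) (by simp; linear_combination e)
  · exact fun e => key 0 1 0 (-1) (by norm_num) (by simp; linear_combination e)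
  · exact fun e => key 1 0 (-1) 0 (by norm_num) (by simp; linear_combination e)
  · exact fun e => key 1 (-1) 1 (-1) (by norm_num) (by simp; linear_combination e)
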